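/- Let G = ℝ^{n+1} be a Grushin space of homogeneous dimension Q = n+2 with Q ≥ 4. Let 1 < p < Q and −Q(p−1) < β < Q − p. Then for every u ∈ C_0^∞(ℝ^{n+1}): ∫_{ℝ^{n+1}} |L_{ϱ,G} u|^p / (ψ^{p/2} ϱ^{β}) dx dt ≥ ((Q(p−1)+β)/p)^p ∫_{ℝ^{n+1}} |∇_{ϱ,G} u|^p / ϱ^{p+β} dx dt, and the constant ((Q(p−1)+β)/p)^p is best possible. -/

import Mathlib

open MeasureTheory Real

noncomputable section

/-- Points of the Grushin space `ℝ^{n+1}`. -/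
abbrev GPt (n : ℕ) := EuclideanSpace ℝ (Fin n) × ℝ

/-- Homogeneous Grushin norm `ϱ(x,t) = (|x|⁴ + 4t²)^{1/4}`. -/
def gNorm {n : ℕ} (z : GPt n) : ℝ := (‖z.1‖ ^ 4 + 4 * z.2 ^ 2) ^ ((1 : ℝ) / 4)

/-- The geometric term `ψ(x,t) = |x|²/ϱ²` (so that `|∇_G ϱ| = ψ^{1/2}`). -/
def gPsi {n : ℕ} (z : GPt n) : ℝ := ‖z.1‖ ^ 2 / gNorm z ^ 2

/-- Radial derivative `∂_ϱ u(x,t) = d/ds u(s·x/ϱ, s²·t/ϱ²)` at `s = ϱ(x,t)`. -/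
def radialDeriv {n : ℕ} (u : GPt n → ℝ) (z : GPt n) : ℝ :=
  deriv (fun s : ℝ => u ((s / gNorm z) • z.1, (s ^ 2 / gNorm z ^ 2) * z.2)) (gNorm z)

/-- The scaled function `u_R(x,t) = u(R·x/ϱ, R²·t/ϱ²)`. -/
def uScaled {n : ℕ} (R : ℝ) (u : GPt n → ℝ) (z : GPt n) : ℝ :=
  u ((R / gNorm z) • z.1, (R ^ 2 / gNorm z ^ 2) * z.2)

/-- Radial Grushin operator `L_{ϱ,G} u = ψ(∂_ϱ² u + ((Q−1)/ϱ) ∂_ϱ u)`. -/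
def radialLap {n : ℕ} (Q : ℝ) (u : GPt n → ℝ) (z : GPt n) : ℝ :=
  gPsi z * (radialDeriv (radialDeriv u) z + (Q - 1) / gNorm z * radialDeriv u z)

/-- The Grushin operator `L_G u = Δ_x u + |x|² ∂_t² u`. -/
def grushinOp {n : ℕ} (u : GPt n → ℝ) (z : GPt n) : ℝ :=
  (∑ i : Fin n,
      deriv (deriv fun s : ℝ => u (z.1 + s • EuclideanSpace.single i (1 : ℝ), z.2)) 0)
    + ‖z.1‖ ^ 2 * deriv (deriv fun s : ℝ => u (z.1, z.2 + s)) 0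

/-- The first-order operator `T_β(u) = ψ^{1/2}(∂_ϱ u + ((Q−β−2)/(2ϱ)) u)`. -/
def Tweight {n : ℕ} (Q β : ℝ) (u : GPt n → ℝ) (z : GPt n) : ℝ :=
  Real.sqrt (gPsi z) * (radialDeriv u z + (Q - β - 2) / (2 * gNorm z) * u z)

/-- The iterated operator `R_{β,k} = T_β ∘ T_{β+2} ∘ ⋯ ∘ T_{β+2k}`. -/
def Rop {n : ℕ} (Q : ℝ) : ℕ → ℝ → (GPt n → ℝ) → GPt n → ℝ
  | 0, β, u => Tweight Q β u
  | k + 1, β, u => Tweight Q β (Rop Q k (β + 2) u)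

/-- The constants `Λ_k(Q,p,β)`. -/
def Lam (Q p β : ℝ) (k : ℕ) : ℝ :=
  if k = 1 then ((Q - p - β) / p) ^ p
  else ((Q * (p - 1) + β + ((k : ℝ) - 2) * p) * (Q - β - (k : ℝ) * p) / p ^ 2) ^ p

/-- The constant `C_{2l,p,β} = ∏_{i=1}^{l} Λ_{2i}(Q,p,β)`. -/
def Ceven (Q p β : ℝ) (l : ℕ) : ℝ := ∏ i ∈ Finset.range l, Lam Q p β (2 * i + 2)

/-- The constant `C_{2l+1,p,β} = ∏_{i=0}^{l} Λ_{2i+1}(Q,p,β)`. -/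
def Codd (Q p β : ℝ) (l : ℕ) : ℝ := ∏ i ∈ Finset.range (l + 1), Lam Q p β (2 * i + 1)

/-- The constant `A_m = ((Q+m)² + (Q−4−m)²)/4`. -/
def Aconst (Q m : ℝ) : ℝ := ((Q + m) ^ 2 + (Q - 4 - m) ^ 2) / 4

/-- The constants `D_{j,m,β}` given by the iteration
`D_{j,m+1,β} = Λ_{2m+2}(Q,2,β) D_{j−2,m,β} + A_{β+4m} D_{j−1,m,β} + D_{j,m,β}`,
with `D_{0,0,β} = 1` (and vanishing off-range values). -/
def Dconst (Q β : ℝ) : ℕ → ℤ → ℝ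
  | 0, j => if j = 0 then 1 else 0
  | m + 1, j =>
      Lam Q 2 β (2 * m + 2) * Dconst Q β m (j - 2)
        + Aconst Q (β + 4 * (m : ℝ)) * Dconst Q β m (j - 1) + Dconst Q β m j

/-- The constants `B_{j,m,β,k}` given by the iteration
`B_{j,m+1,β,k} = Λ_2(Q,2,β+2k+2) B_{j−2,m,β+4,k} + A_{β+2k+2} B_{j−1,m,β+2,k+1} + B_{j,m,β,k+2}`,
with `B_{0,0,β,k} = 1` (and vanishing off-range values). -/
def Bconst (Q : ℝ) : ℕ → ℤ → ℝ → ℝ → ℝ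
  | 0, j, _, _ => if j = 0 then 1 else 0
  | m + 1, j, β, k =>
      Lam Q 2 (β + 2 * k + 2) 2 * Bconst Q m (j - 2) (β + 4) k
        + Aconst Q (β + 2 * k + 2) * Bconst Q m (j - 1) (β + 2) (k + 1)
        + Bconst Q m j β (k + 2)

/-- Surface measure `ω_n` of the unit sphere in `ℝ^n`. -/
def sphSurface (n : ℕ) : ℝ :=
  n * (volume (Metric.ball (0 : EuclideanSpace ℝ (Fin n)) 1)).toReal

/-- The integral constant `C^{Ω,m} = ω_n ∫_0^π (sin φ)^{(n+m)/2} dφ`. -/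
def COmega (n m : ℕ) : ℝ :=
  sphSurface n * ∫ φ in (0 : ℝ)..π, Real.sin φ ^ (((n : ℝ) + (m : ℝ)) / 2)

/-- The sharp Frank–Seiringer constant `c_p = min_{0<t≤1/2} [(1−t)^p − t^p + p t^{p−1}]`. -/
def cFS (p : ℝ) : ℝ :=
  sInf {y : ℝ | ∃ t : ℝ, 0 < t ∧ t ≤ 1 / 2 ∧ y = (1 - t) ^ p - t ^ p + p * t ^ (p - 1)}

/-- Compactly supported smooth test functions with (closed) support inside `s`. -/
def IsTest {n : ℕ} (s : Set (GPt n)) (u : GPt n → ℝ) : Prop :=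
  ContDiff ℝ (⊤ : ℕ∞) u ∧ HasCompactSupport u ∧ tsupport u ⊆ s

/-- A function on the Grushin space is radial if it depends only on the homogeneous norm. -/
def IsRadial {n : ℕ} (u : GPt n → ℝ) : Prop :=
  ∃ f : ℝ → ℝ, ∀ z, u z = f (gNorm z)

/-- The distance function `d_H(u,R)`. -/
def dH {n : ℕ} (Q p β R : ℝ) (u : GPt n → ℝ) : ℝ :=
  (∫ z : GPt n,
      |u z - R ^ ((Q - p - β) / p) * uScaled R u z * gNorm z ^ (-((Q - p - β) / p))| ^ p *
        gPsi z ^ (p / 2) / (|Real.log (R / gNorm z)| ^ p * gNorm z ^ (p + β))) ^ (1 / p)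

/-- The distance function `d_R(u,k,β)`. -/
def dRdist {n : ℕ} (Q p β R : ℝ) (k : ℕ) (u : GPt n → ℝ) : ℝ :=
  (∫ z : GPt n,
      (|u z| ^ ((p - 2) / 2) * u z -
          |uScaled R u z| ^ ((p - 2) / 2) * uScaled R u z *
            (gNorm z / R) ^ (-((Q - (k : ℝ) * p - β) / 2))) ^ 2 *
        gPsi z ^ (p / 2) /
        (gNorm z ^ ((k : ℝ) * p + β) * Real.log (R / gNorm z) ^ 2)) ^ ((1 : ℝ) / 2)

/-- The distance function `d_C(u,R)`. -/
def dCdist {n : ℕ} (Q p R : ℝ) (u : GPt n → ℝ) : ℝ :=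
  (∫ z in {z : GPt n | gNorm z < 1},
      |u z - Real.log (1 / gNorm z) ^ ((p - 1) / p) * R ^ ((p - 1) / p) *
          uScaled (Real.exp (-1 / R)) u z| ^ p *
        gPsi z ^ (p / 2) /
        (gNorm z ^ Q * Real.log (1 / gNorm z) ^ p *
          |Real.log (R * Real.log (1 / gNorm z))| ^ p)) ^ (1 / p)

section Auxiliary

variable {n : ℕ}

/-- The anisotropic dilation `(x,t) ↦ (σx, σ²t)`. -/
def gDil (σ : ℝ) (z : GPt n) : GPt n := (σ • z.1, σ ^ 2 * z.2)

/-- The infinitesimal generator `x·∂_x + 2t∂_t` of the dilations. -/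
def gEuler (u : GPt n → ℝ) (z : GPt n) : ℝ := fderiv ℝ u z (z.1, 2 * z.2)

lemma gNorm_nonneg (z : GPt n) : 0 ≤ gNorm z := by
  unfold gNorm; positivity

lemma gNorm_pow_four (z : GPt n) : gNorm z ^ 4 = ‖z.1‖ ^ 4 + 4 * z.2 ^ 2 := by
  unfold gNorm
  rw [← Real.rpow_natCast, ← Real.rpow_mul (by positivity)]
  norm_num

lemma gNorm_eq_zero_iff (z : GPt n) : gNorm z = 0 ↔ z = 0 := by
  rw [← pow_eq_zero_iff (n := 4) (by norm_num), gNorm_pow_four]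
  constructor
  · intro h
    have h1 : ‖z.1‖ ^ 4 = 0 := by nlinarith [sq_nonneg z.2, pow_nonneg (norm_nonneg z.1) 4]
    have h2 : z.2 ^ 2 = 0 := by nlinarith [sq_nonneg z.2, pow_nonneg (norm_nonneg z.1) 4]
    have h3 : ‖z.1‖ = 0 := by simpa using h1
    exact Prod.ext (by simpa using h3) (by simpa using h2)
  · rintro rfl; simp

lemma gNorm_zero : gNorm (0 : GPt n) = 0 := (gNorm_eq_zero_iff 0).2 rfl

lemma gNorm_pos {z : GPt n} (hz : z ≠ 0) : 0 < gNorm z :=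
  lt_of_le_of_ne (gNorm_nonneg z) fun h => hz ((gNorm_eq_zero_iff z).1 h.symm)

lemma gNorm_dil {σ : ℝ} (hσ : 0 ≤ σ) (z : GPt n) : gNorm (gDil σ z) = σ * gNorm z := by
  refine (pow_left_inj₀ (gNorm_nonneg _) (mul_nonneg hσ (gNorm_nonneg z))
    (by norm_num : (4 : ℕ) ≠ 0)).1 ?_
  rw [mul_pow, gNorm_pow_four, gNorm_pow_four]
  simp only [gDil, norm_smul, Real.norm_eq_abs, abs_of_nonneg hσ]
  ring

lemma continuous_gNorm : Continuous (gNorm : GPt n → ℝ) := by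
  unfold gNorm
  exact Continuous.rpow_const (by fun_prop) fun _ => Or.inr (by norm_num)

lemma measurable_gPsi : Measurable (gPsi : GPt n → ℝ) := by
  unfold gPsi
  exact (by fun_prop : Measurable fun z : GPt n => ‖z.1‖ ^ 2).div
    (continuous_gNorm.measurable.pow_const 2)

lemma gPsi_nonneg (z : GPt n) : 0 ≤ gPsi z := by
  unfold gPsi; positivity

lemma norm_fst_le_gNorm (z : GPt n) : ‖z.1‖ ≤ gNorm z := by
  refine (pow_le_pow_iff_left₀ (norm_nonneg _) (gNorm_nonneg z) (by norm_num : (4 : ℕ) ≠ 0)).1 ?_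
  rw [gNorm_pow_four]
  nlinarith [sq_nonneg z.2]

lemma abs_snd_le_gNorm_sq (z : GPt n) : |z.2| ≤ gNorm z ^ 2 := by
  refine abs_le_of_sq_le_sq ?_ (sq_nonneg _)
  rw [← pow_mul, gNorm_pow_four]
  nlinarith [sq_nonneg z.2, pow_nonneg (norm_nonneg z.1) 4]

lemma norm_le_of_gNorm_le {R : ℝ} (hR : 1 ≤ R) {z : GPt n} (hz : gNorm z ≤ R) :
    ‖z‖ ≤ R * gNorm z := by
  have h0 := gNorm_nonneg z
  rw [Prod.norm_def]
  refine max_le ((norm_fst_le_gNorm z).trans (by nlinarith)) ?_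
  exact (abs_snd_le_gNorm_sq z).trans (by nlinarith)

lemma gNorm_le_of_norm_le {R : ℝ} (hR : 1 ≤ R) {z : GPt n} (hz : ‖z‖ ≤ R) :
    gNorm z ≤ 2 * R := by
  have h1 : ‖z.1‖ ≤ R := (norm_fst_le z).trans hz
  have h2 : |z.2| ≤ R := (norm_snd_le z).trans hz
  refine (pow_le_pow_iff_left₀ (gNorm_nonneg z) (by linarith) (by norm_num : (4 : ℕ) ≠ 0)).1 ?_
  rw [gNorm_pow_four]
  have h3 : ‖z.1‖ ^ 4 ≤ R ^ 4 := pow_le_pow_left₀ (norm_nonneg _) h1 4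
  have h4 : z.2 ^ 2 ≤ R ^ 2 := sq_le_sq' (by linarith [(abs_le.1 h2).1]) (abs_le.1 h2).2
  have h5 : R ^ 2 ≤ R ^ 4 := pow_le_pow_right₀ hR (by norm_num)
  nlinarith [mul_pow 2 R 4]

lemma gPsi_le_one (z : GPt n) : gPsi z ≤ 1 :=
  div_le_one_of_le₀ (pow_le_pow_left₀ (norm_nonneg _) (norm_fst_le_gNorm z) 2) (sq_nonneg _)

lemma gPsi_dil {σ : ℝ} (hσ : 0 < σ) (z : GPt n) : gPsi (gDil σ z) = gPsi z := by
  unfold gPsi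
  rw [gNorm_dil hσ.le]
  simp only [gDil, norm_smul, Real.norm_eq_abs, abs_of_pos hσ, mul_pow]
  exact mul_div_mul_left _ _ (by positivity)

lemma ae_fst_ne_zero (hn : n ≠ 0) : ∀ᵐ z : GPt n, z.1 ≠ 0 := by
  have : NeZero n := ⟨hn⟩
  have h : (volume : Measure (GPt n)) ({0} ×ˢ Set.univ) = 0 := by
    rw [Measure.volume_eq_prod, Measure.prod_prod]
    simp
  rw [ae_iff]
  refine measure_mono_null (fun z hz => ?_) h
  simpa using hz

lemma gPsi_pos {z : GPt n} (hz : z.1 ≠ 0) : 0 < gPsi z :=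
  div_pos (by positivity) (pow_pos (gNorm_pos fun h => hz (by simp [h])) 2)

lemma lintegral_comp_gDil {σ : ℝ} (hσ : 0 < σ) {g : GPt n → ENNReal} (hg : Measurable g) :
    ∫⁻ z, g (gDil σ z) = ENNReal.ofReal (σ ^ (-((n : ℝ) + 2))) * ∫⁻ z, g z := by
  have hmap : Measure.map (gDil σ) (volume : Measure (GPt n))
      = ENNReal.ofReal (σ ^ (-((n : ℝ) + 2))) • volume := by
    have h1 : (gDil σ : GPt n → GPt n) = Prod.map (fun x => σ • x) (fun t => σ ^ 2 • t) := by
      ext z <;> simp [gDil]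
    have h2 := Measure.map_addHaar_smul (volume : Measure (EuclideanSpace ℝ (Fin n))) hσ.ne'
    have h3 := Measure.map_addHaar_smul (volume : Measure ℝ) (pow_pos hσ 2).ne'
    rw [h1, Measure.volume_eq_prod, ← Measure.map_prod_map _ _ (by fun_prop) (by fun_prop)]
    rw [h2, h3, Measure.prod_smul_left, Measure.prod_smul_right, smul_smul]
    congr 1
    rw [← ENNReal.ofReal_mul (by positivity), abs_of_pos (by positivity),
      abs_of_pos (by positivity)]
    congr 1
    rw [Real.rpow_neg hσ.le, Real.rpow_add hσ, Real.rpow_natCast, Real.rpow_two]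
    simp [mul_comm]
  have hm : Measurable (gDil σ : GPt n → GPt n) := by
    unfold gDil; fun_prop
  rw [← lintegral_map hg hm, hmap, lintegral_smul_measure, smul_eq_mul]

/-- The dilation-homogeneous density `ψ^{p/2} ϱ^{-Q}`, `Q = n + 2`. -/
def polarDensity (p : ℝ) (z : GPt n) : ℝ := gPsi z ^ (p / 2) * gNorm z ^ (-((n : ℝ) + 2))

lemma polarDensity_nonneg (p : ℝ) (z : GPt n) : 0 ≤ polarDensity p z :=
  mul_nonneg (Real.rpow_nonneg (gPsi_nonneg z) _) (Real.rpow_nonneg (gNorm_nonneg z) _)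

lemma measurable_polarDensity (p : ℝ) : Measurable (polarDensity p : GPt n → ℝ) := by
  unfold polarDensity
  exact (measurable_gPsi.pow_const _).mul (continuous_gNorm.measurable.pow_const _)

lemma polarDensity_dil {σ : ℝ} (hσ : 0 < σ) (p : ℝ) (z : GPt n) :
    polarDensity p (gDil σ z) = σ ^ (-((n : ℝ) + 2)) * polarDensity p z := by
  unfold polarDensity
  rw [gPsi_dil hσ, gNorm_dil hσ.le, Real.mul_rpow hσ.le (gNorm_nonneg z)]
  ring

lemma polarDensity_zero (p : ℝ) : polarDensity p (0 : GPt n) = 0 := by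
  have : (-((n : ℝ) + 2)) ≠ 0 := by
    have : (0 : ℝ) ≤ n := n.cast_nonneg
    linarith
  rw [polarDensity, gNorm_zero, Real.zero_rpow this, mul_zero]

/-- The measure `ψ^{p/2} ϱ^{-Q} dz`. -/
def polarMeasure (n : ℕ) (p : ℝ) : Measure (GPt n) :=
  volume.withDensity fun z => ENNReal.ofReal (polarDensity p z)

lemma measurable_log_gNorm : Measurable fun z : GPt n => Real.log (gNorm z) :=
  Real.measurable_log.comp continuous_gNorm.measurable

lemma lintegral_map_polarMeasure (p : ℝ) {G : ℝ → ENNReal} (hG : Measurable G) :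
    ∫⁻ s, G s ∂((polarMeasure n p).map fun z => Real.log (gNorm z))
      = ∫⁻ z : GPt n, ENNReal.ofReal (polarDensity p z) * G (Real.log (gNorm z)) := by
  rw [lintegral_map hG measurable_log_gNorm, polarMeasure]
  exact lintegral_withDensity_eq_lintegral_mul _ (measurable_polarDensity p).ennreal_ofReal
    (hG.comp measurable_log_gNorm)

lemma isAddLeftInvariant_map_polarMeasure (p : ℝ) :
    ((polarMeasure n p).map fun z => Real.log (gNorm z)).IsAddLeftInvariant := by
  refine ⟨fun a => ?_⟩
  refine Measure.ext_of_lintegral _ fun G hG => ?_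
  rw [lintegral_map hG (by fun_prop), lintegral_map_polarMeasure p (by fun_prop),
    lintegral_map_polarMeasure p hG]
  have key : ∀ z : GPt n, ENNReal.ofReal (polarDensity p z) * G (a + Real.log (gNorm z))
      = ENNReal.ofReal (Real.exp a ^ ((n : ℝ) + 2)) *
        (ENNReal.ofReal (polarDensity p (gDil (Real.exp a) z)) *
          G (Real.log (gNorm (gDil (Real.exp a) z)))) := by
    intro z
    rcases eq_or_ne z 0 with rfl | hz
    · have : gDil (Real.exp a) (0 : GPt n) = 0 := by simp [gDil]
      simp [this, polarDensity_zero]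
    · rw [gNorm_dil (Real.exp_pos a).le, Real.log_mul (Real.exp_pos a).ne' (gNorm_pos hz).ne',
        Real.log_exp, ← mul_assoc, ← ENNReal.ofReal_mul (by positivity),
        polarDensity_dil (Real.exp_pos a), ← mul_assoc, ← Real.rpow_add (Real.exp_pos a)]
      simp
  have hmeas : Measurable fun z : GPt n =>
      ENNReal.ofReal (polarDensity p z) * G (Real.log (gNorm z)) :=
    (measurable_polarDensity p).ennreal_ofReal.mul (hG.comp measurable_log_gNorm)
  rw [lintegral_congr key, lintegral_const_mul' _ _ ENNReal.ofReal_ne_top,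
    lintegral_comp_gDil (Real.exp_pos a) hmeas, ← mul_assoc,
    ← ENNReal.ofReal_mul (by positivity), ← Real.rpow_add (Real.exp_pos a)]
  simp

lemma isFiniteMeasureOnCompacts_map_polarMeasure {p : ℝ} (hp : 0 ≤ p) :
    IsFiniteMeasureOnCompacts ((polarMeasure n p).map fun z => Real.log (gNorm z)) := by
  refine ⟨fun K hK => ?_⟩
  obtain ⟨b, hb⟩ := hK.isBounded.subset_closedBall 0
  rw [Measure.map_apply measurable_log_gNorm hK.measurableSet]
  set b' := max b 0
  have hsub : (fun z : GPt n => Real.log (gNorm z)) ⁻¹' K ⊆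
      {z | Real.exp (-b') ≤ gNorm z ∧ gNorm z ≤ Real.exp b'} ∪ {0} := by
    intro z hz
    rcases eq_or_ne z 0 with rfl | hz0
    · simp
    left
    have := hb hz
    rw [Metric.mem_closedBall, dist_zero_right, Real.norm_eq_abs] at this
    have h' := abs_le.1 (this.trans (le_max_left b 0))
    exact ⟨(Real.le_log_iff_exp_le (gNorm_pos hz0)).1 h'.1,
      (Real.log_le_iff_le_exp (gNorm_pos hz0)).1 h'.2⟩
  have hmeasS : MeasurableSet
      ({z : GPt n | Real.exp (-b') ≤ gNorm z ∧ gNorm z ≤ Real.exp b'} ∪ {0}) := by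
    refine MeasurableSet.union ?_ (measurableSet_singleton 0)
    exact (measurableSet_le measurable_const continuous_gNorm.measurable).inter
      (measurableSet_le continuous_gNorm.measurable measurable_const)
  refine (measure_mono hsub).trans_lt ?_
  rw [polarMeasure, withDensity_apply _ hmeasS]
  have hbound : ∀ z ∈ ({z : GPt n | Real.exp (-b') ≤ gNorm z ∧ gNorm z ≤ Real.exp b'} ∪ {0}),
      ENNReal.ofReal (polarDensity p z) ≤
        ENNReal.ofReal (Real.exp (-b') ^ (-((n : ℝ) + 2))) := by
    rintro z (hz | hz)
    · refine ENNReal.ofReal_le_ofReal ?_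
      unfold polarDensity
      have h1 : gPsi z ^ (p / 2) ≤ 1 :=
        Real.rpow_le_one (gPsi_nonneg z) (gPsi_le_one z) (by linarith)
      have h2 : gNorm z ^ (-((n : ℝ) + 2)) ≤ Real.exp (-b') ^ (-((n : ℝ) + 2)) :=
        Real.rpow_le_rpow_of_nonpos (Real.exp_pos _) hz.1 (by
          have : (0 : ℝ) ≤ n := n.cast_nonneg
          linarith)
      calc _ ≤ 1 * gNorm z ^ (-((n : ℝ) + 2)) :=
            mul_le_mul_of_nonneg_right h1 (Real.rpow_nonneg (gNorm_nonneg z) _)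
        _ ≤ _ := by rwa [one_mul]
    · rw [Set.mem_singleton_iff.1 hz, polarDensity_zero]
      simp
  refine (setLIntegral_mono measurable_const hbound).trans_lt ?_
  rw [setLIntegral_const]
  refine ENNReal.mul_lt_top ENNReal.ofReal_lt_top ?_
  refine (measure_mono (fun z hz => ?_ : _ ⊆ Metric.closedBall (0 : GPt n)
    (Real.exp b' * Real.exp b'))).trans_lt measure_closedBall_lt_top
  have h1 : 1 ≤ Real.exp b' := Real.one_le_exp (le_max_right b 0)
  rw [Metric.mem_closedBall, dist_zero_right]
  rcases hz with hz | hz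
  · exact (norm_le_of_gNorm_le h1 hz.2).trans
      (mul_le_mul_of_nonneg_left hz.2 (Real.exp_pos _).le)
  · rw [Set.mem_singleton_iff.1 hz, norm_zero]
    positivity

/-- Polar coordinates for the weight `ψ^{p/2} ϱ^{-Q}`: its push-forward under `log ϱ` is a
finite positive multiple of Lebesgue measure. -/
lemma exists_map_polarMeasure_eq (hn : n ≠ 0) {p : ℝ} (hp : 0 ≤ p) :
    ∃ C : NNReal, 0 < C ∧
      (polarMeasure n p).map (fun z => Real.log (gNorm z)) = C • (volume : Measure ℝ) := by
  have := isAddLeftInvariant_map_polarMeasure (n := n) p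
  have := isFiniteMeasureOnCompacts_map_polarMeasure (n := n) hp
  have h := Measure.isAddLeftInvariant_eq_smul
    ((polarMeasure n p).map (fun z => Real.log (gNorm z))) volume
  refine ⟨_, pos_iff_ne_zero.2 fun h0 => ?_, h⟩
  rw [h0, zero_smul, Measure.map_eq_zero_iff measurable_log_gNorm.aemeasurable, polarMeasure,
    withDensity_eq_zero_iff (measurable_polarDensity p).ennreal_ofReal.aemeasurable] at h
  have hfalse : ∀ᵐ _ : GPt n, False := by
    filter_upwards [h, ae_fst_ne_zero hn] with z hz hz1
    have : 0 < polarDensity p z := mul_pos (Real.rpow_pos_of_pos (gPsi_pos hz1) _)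
      (Real.rpow_pos_of_pos (gNorm_pos fun h => hz1 (by simp [h])) _)
    simp only [Pi.zero_apply, ENNReal.ofReal_eq_zero] at hz
    linarith
  have : (volume : Measure (GPt n)) = 0 := by
    rw [← ae_eq_bot]
    exact Filter.eventually_false_iff_eq_bot.1 hfalse
  exact (NeZero.ne (volume : Measure (GPt n))) this

lemma hasDerivAt_comp_gDil {v : GPt n → ℝ} {z : GPt n} {σ : ℝ} (hσ : σ ≠ 0)
    (hv : DifferentiableAt ℝ v (gDil σ z)) :
    HasDerivAt (fun τ => v (gDil τ z)) (gEuler v (gDil σ z) / σ) σ := by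
  have h1 : HasDerivAt (fun τ : ℝ => τ • z.1) z.1 σ := by
    simpa using (hasDerivAt_id σ).smul_const z.1
  have h2 : HasDerivAt (fun τ : ℝ => τ ^ 2 * z.2) (2 * σ * z.2) σ := by
    simpa using (hasDerivAt_pow 2 σ).mul_const z.2
  have h3 : HasDerivAt (fun τ : ℝ => gDil τ z) (z.1, 2 * σ * z.2) σ := h1.prodMk h2
  have h4 := hv.hasFDerivAt.comp_hasDerivAt σ h3
  have h5 : gEuler v (gDil σ z) / σ = fderiv ℝ v (gDil σ z) (z.1, 2 * σ * z.2) := by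
    rw [div_eq_iff hσ, mul_comm, ← smul_eq_mul, ← map_smul, gEuler]
    congr 1
    simp only [gDil, Prod.smul_mk, smul_eq_mul]
    congr 1
    ring
  rw [h5]
  exact h4

lemma gDil_one (z : GPt n) : gDil 1 z = z := by simp [gDil]

lemma continuous_gDil : Continuous fun x : ℝ × GPt n => gDil x.1 x.2 := by
  unfold gDil; fun_prop

lemma radialDeriv_eq_deriv_gDil (u : GPt n → ℝ) (z : GPt n) :
    radialDeriv u z = deriv (fun s => u (gDil (s / gNorm z) z)) (gNorm z) := by
  simp only [radialDeriv, gDil, div_pow]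

lemma hasDerivAt_radial {v : GPt n → ℝ} {z : GPt n} (hz : z ≠ 0) (hv : DifferentiableAt ℝ v z) :
    HasDerivAt (fun s => v (gDil (s / gNorm z) z)) (gEuler v z / gNorm z) (gNorm z) := by
  have h0 := (gNorm_pos hz).ne'
  have h1 : HasDerivAt (fun s : ℝ => s / gNorm z) (1 / gNorm z) (gNorm z) :=
    (hasDerivAt_id _).div_const _
  have h2 : HasDerivAt (fun τ => v (gDil τ z)) (gEuler v z) (gNorm z / gNorm z) := by
    rw [div_self h0]
    have := hasDerivAt_comp_gDil (v := v) (z := z) one_ne_zero (by rwa [gDil_one])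
    simpa [gDil_one] using this
  have h3 := HasDerivAt.comp (h := fun s : ℝ => s / gNorm z) (gNorm z) h2 h1
  exact h3.congr_deriv (by ring)

lemma radialDeriv_eq {u : GPt n → ℝ} (hu : Differentiable ℝ u) (z : GPt n) :
    radialDeriv u z = gEuler u z / gNorm z := by
  rw [radialDeriv_eq_deriv_gDil]
  rcases eq_or_ne z 0 with rfl | hz
  · simp [gDil, gNorm_zero]
  · exact (hasDerivAt_radial hz (hu z)).deriv

lemma gNorm_gDil_div {z : GPt n} (hz : z ≠ 0) {s : ℝ} (hs : 0 < s) :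
    gNorm (gDil (s / gNorm z) z) = s := by
  rw [gNorm_dil (div_pos hs (gNorm_pos hz)).le, div_mul_cancel₀ _ (gNorm_pos hz).ne']

lemma radialDeriv_radialDeriv_eq {u : GPt n → ℝ} (hu : Differentiable ℝ u)
    (hu' : Differentiable ℝ (gEuler u)) {z : GPt n} (hz : z ≠ 0) :
    radialDeriv (radialDeriv u) z = (gEuler (gEuler u) z - gEuler u z) / gNorm z ^ 2 := by
  have h0 := gNorm_pos hz
  rw [radialDeriv_eq_deriv_gDil]
  have h1 := (hasDerivAt_radial hz (hu' z)).div (hasDerivAt_id (gNorm z)) h0.ne'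
  have h2 : (fun s => radialDeriv u (gDil (s / gNorm z) z)) =ᶠ[nhds (gNorm z)]
      ((fun s => gEuler u (gDil (s / gNorm z) z)) / id) := by
    filter_upwards [lt_mem_nhds h0] with s hs
    rw [radialDeriv_eq hu, gNorm_gDil_div hz hs]
    rfl
  rw [h2.deriv_eq, h1.deriv, div_self h0.ne', gDil_one]
  simp only [id]
  field_simp

lemma radialLap_eq {u : GPt n → ℝ} (hu : Differentiable ℝ u)
    (hu' : Differentiable ℝ (gEuler u)) {z : GPt n} (hz : z ≠ 0) :
    radialLap ((n : ℝ) + 2) u z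
      = gPsi z * ((gEuler (gEuler u) z + n * gEuler u z) / gNorm z ^ 2) := by
  have h0 := (gNorm_pos hz).ne'
  rw [radialLap, radialDeriv_radialDeriv_eq hu hu' hz, radialDeriv_eq hu]
  congr 1
  field_simp
  ring

lemma contDiff_gEuler {u : GPt n → ℝ} (hu : ContDiff ℝ (⊤ : ℕ∞) u) :
    ContDiff ℝ (⊤ : ℕ∞) (gEuler u) := by
  unfold gEuler
  exact (hu.fderiv_right (by simp)).clm_apply (by fun_prop)

lemma hasCompactSupport_gEuler {u : GPt n → ℝ} (hu : HasCompactSupport u) :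
    HasCompactSupport (gEuler u) := by
  refine (hu.fderiv (𝕜 := ℝ)).mono fun z hz h => hz ?_
  simp only [gEuler, h, zero_apply]

/-- Reconstruction of a function from `E v + n v` along the dilations. -/
lemma eq_integral_gDil (hn : 2 ≤ n) {v : GPt n → ℝ} (hv : ContDiff ℝ (⊤ : ℕ∞) v) (z : GPt n) :
    v z = ∫ σ in (0 : ℝ)..1, σ ^ (n - 1) * (gEuler v (gDil σ z) + n * v (gDil σ z)) := by
  have hcE := (contDiff_gEuler hv).continuous
  have hcv := hv.continuous
  have hcd : Continuous fun σ : ℝ => gDil σ z :=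
    continuous_gDil.comp (continuous_id.prodMk continuous_const)
  have h := intervalIntegral.integral_eq_sub_of_hasDerivAt_of_le (a := 0) (b := 1)
    (f := fun σ : ℝ => σ ^ n * v (gDil σ z))
    (f' := fun σ : ℝ => σ ^ (n - 1) * (gEuler v (gDil σ z) + n * v (gDil σ z)))
    zero_le_one (by fun_prop) ?_ (by apply Continuous.intervalIntegrable; fun_prop)
  · rw [h]
    simp [gDil_one, zero_pow (by omega : n ≠ 0)]
  · intro σ hσ
    have h1 := (hasDerivAt_pow n σ).mul
      (hasDerivAt_comp_gDil hσ.1.ne' (hv.differentiable (by simp) (gDil σ z)))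
    have h0 := hσ.1.ne'
    refine h1.congr_deriv ?_
    rw [← mul_pow_sub_one (by omega : n ≠ 0) σ]
    field_simp
    ring

lemma rpow_lintegral_le_lintegral_rpow {α : Type*} [MeasurableSpace α] {μ : Measure α}
    [IsProbabilityMeasure μ] {p : ℝ} (hp : 1 ≤ p) {f : α → ENNReal} (hf : Measurable f) :
    (∫⁻ a, f a ∂μ) ^ p ≤ ∫⁻ a, f a ^ p ∂μ := by
  have h := eLpNorm'_le_eLpNorm'_of_exponent_le zero_lt_one hp μ hf.aestronglyMeasurable
  have hp0 : 0 < p := zero_lt_one.trans_le hp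
  simp only [eLpNorm', enorm_eq_self, ENNReal.rpow_one, div_one, one_div] at h
  exact (ENNReal.le_rpow_inv_iff hp0).1 h

lemma lintegral_mul_rpow_sub_one {c : ℝ} (hc : 0 < c) :
    ∫⁻ σ in Set.Ioc (0 : ℝ) 1, ENNReal.ofReal (c * σ ^ (c - 1)) = 1 := by
  have h_int : IntervalIntegrable (fun σ : ℝ => c * σ ^ (c - 1)) volume 0 1 :=
    (intervalIntegral.intervalIntegrable_rpow' (by linarith)).const_mul c
  rw [← ofReal_integral_eq_lintegral_ofReal, ← intervalIntegral.integral_of_le zero_le_one,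
    intervalIntegral.integral_const_mul, integral_rpow (Or.inl (by linarith))]
  · simp [hc.ne']
  · exact (intervalIntegrable_iff_integrableOn_Ioc_of_le zero_le_one).1 h_int
  · filter_upwards [ae_restrict_mem measurableSet_Ioc] with σ hσ
    exact mul_nonneg hc.le (Real.rpow_nonneg hσ.1.le _)

/-- Pointwise Jensen bound for the dilation reconstruction formula. -/
lemma ofReal_rpow_abs_le_lintegral (hn : 2 ≤ n) {p c : ℝ} (hp : 1 ≤ p) (hc : 0 < c)
    {v : GPt n → ℝ} (hv : ContDiff ℝ (⊤ : ℕ∞) v) (z : GPt n) :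
    ENNReal.ofReal (c ^ p) * ENNReal.ofReal (|v z| ^ p) ≤
      ∫⁻ σ in Set.Ioc (0 : ℝ) 1, ENNReal.ofReal (c * σ ^ (c - 1 + (n - c) * p)) *
        ENNReal.ofReal (|gEuler v (gDil σ z) + n * v (gDil σ z)| ^ p) := by
  have hp0 : 0 ≤ p := by linarith
  set H : GPt n → ℝ := fun w => gEuler v w + n * v w with hH
  have hHc : Continuous H := (contDiff_gEuler hv).continuous.add
    (continuous_const.mul hv.continuous)
  have hHd : Continuous fun σ : ℝ => H (gDil σ z) :=
    hHc.comp (continuous_gDil.comp (continuous_id.prodMk continuous_const))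
  have hd : Measurable fun σ : ℝ => ENNReal.ofReal (c * σ ^ (c - 1)) := by fun_prop
  set m : Measure ℝ := (volume.restrict (Set.Ioc (0 : ℝ) 1)).withDensity
    fun σ => ENNReal.ofReal (c * σ ^ (c - 1)) with hm
  have : IsProbabilityMeasure m := ⟨by
    rw [hm, withDensity_apply _ MeasurableSet.univ, Measure.restrict_univ,
      lintegral_mul_rpow_sub_one hc]⟩
  set g : ℝ → ENNReal := fun σ => ENNReal.ofReal (σ ^ (n - c) * |H (gDil σ z)|) with hg
  have hgm : Measurable g := by
    refine Measurable.ennreal_ofReal ?_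
    exact Measurable.mul (by fun_prop) hHd.abs.measurable
  have h1 : ENNReal.ofReal (c * |v z|) ≤ ∫⁻ σ, g σ ∂m := by
    rw [hm, lintegral_withDensity_eq_lintegral_mul _ hd hgm]
    have hrep := eq_integral_gDil hn hv z
    rw [intervalIntegral.integral_of_le zero_le_one] at hrep
    rw [ENNReal.ofReal_mul hc.le, ← Real.enorm_eq_ofReal_abs, hrep]
    refine (mul_le_mul_right (enorm_integral_le_lintegral_enorm _) _).trans ?_
    rw [← lintegral_const_mul' _ _ ENNReal.ofReal_ne_top]
    refine le_of_eq (setLIntegral_congr_fun measurableSet_Ioc fun σ hσ => ?_)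
    have hσ0 : 0 < σ := hσ.1
    simp only [Pi.mul_apply, hg]
    rw [Real.enorm_eq_ofReal_abs, ← ENNReal.ofReal_mul hc.le, ← ENNReal.ofReal_mul (by positivity)]
    congr 1
    rw [abs_mul, abs_of_nonneg (by positivity)]
    have : σ ^ (n - 1) = σ ^ (c - 1) * σ ^ ((n : ℝ) - c) := by
      rw [← Real.rpow_add hσ0, ← Real.rpow_natCast, Nat.cast_sub (by omega)]
      congr 1
      push_cast
      ring
    rw [this]
    ring
  calc ENNReal.ofReal (c ^ p) * ENNReal.ofReal (|v z| ^ p)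
      = ENNReal.ofReal (c * |v z|) ^ p := by
        rw [← ENNReal.ofReal_mul (by positivity), ← Real.mul_rpow hc.le (abs_nonneg _),
          ENNReal.ofReal_rpow_of_nonneg (by positivity) hp0]
    _ ≤ (∫⁻ σ, g σ ∂m) ^ p := ENNReal.rpow_le_rpow h1 hp0
    _ ≤ ∫⁻ σ, g σ ^ p ∂m := rpow_lintegral_le_lintegral_rpow hp hgm
    _ = _ := by
        rw [hm, lintegral_withDensity_eq_lintegral_mul _ hd (hgm.pow_const p)]
        refine setLIntegral_congr_fun measurableSet_Ioc fun σ hσ => ?_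
        have hσ0 : 0 < σ := hσ.1
        simp only [Pi.mul_apply, hg]
        rw [ENNReal.ofReal_rpow_of_nonneg (by positivity) hp0,
          Real.mul_rpow (by positivity) (abs_nonneg _), ← ENNReal.ofReal_mul (by positivity),
          ← ENNReal.ofReal_mul (by positivity), ← Real.rpow_mul hσ0.le,
          Real.rpow_add hσ0]
        congr 1
        ring

/-- The weight `ψ^{p/2} ϱ^{-(2p+β)}`. -/
def hardyWeight (p β : ℝ) (z : GPt n) : ℝ := gPsi z ^ (p / 2) * gNorm z ^ (-(2 * p + β))

lemma hardyWeight_nonneg (p β : ℝ) (z : GPt n) : 0 ≤ hardyWeight p β z :=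
  mul_nonneg (Real.rpow_nonneg (gPsi_nonneg z) _) (Real.rpow_nonneg (gNorm_nonneg z) _)

lemma measurable_hardyWeight (p β : ℝ) : Measurable (hardyWeight p β : GPt n → ℝ) := by
  unfold hardyWeight
  exact (measurable_gPsi.pow_const _).mul (continuous_gNorm.measurable.pow_const _)

lemma hardyWeight_dil {σ : ℝ} (hσ : 0 < σ) (p β : ℝ) (z : GPt n) :
    hardyWeight p β (gDil σ z) = σ ^ (-(2 * p + β)) * hardyWeight p β z := by
  unfold hardyWeight
  rw [gPsi_dil hσ, gNorm_dil hσ.le, Real.mul_rpow hσ.le (gNorm_nonneg z)]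
  ring

lemma lintegral_hardyWeight_mul_comp_gDil {σ : ℝ} (hσ : 0 < σ) (p β : ℝ) {g : GPt n → ENNReal}
    (hg : Measurable g) :
    ∫⁻ z, ENNReal.ofReal (hardyWeight p β z) * g (gDil σ z)
      = ENNReal.ofReal (σ ^ (2 * p + β - (n + 2))) *
        ∫⁻ z, ENNReal.ofReal (hardyWeight p β z) * g z := by
  have key : ∀ z : GPt n, ENNReal.ofReal (hardyWeight p β z) * g (gDil σ z)
      = ENNReal.ofReal (σ ^ (2 * p + β)) *
        (ENNReal.ofReal (hardyWeight p β (gDil σ z)) * g (gDil σ z)) := by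
    intro z
    rw [hardyWeight_dil hσ, ← mul_assoc, ← ENNReal.ofReal_mul (by positivity), ← mul_assoc,
      ← Real.rpow_add hσ]
    simp
  have hm : Measurable fun z => ENNReal.ofReal (hardyWeight p β z) * g z :=
    (measurable_hardyWeight p β).ennreal_ofReal.mul hg
  rw [lintegral_congr key, lintegral_const_mul' _ _ ENNReal.ofReal_ne_top,
    lintegral_comp_gDil hσ hm, ← mul_assoc,
    ← ENNReal.ofReal_mul (by positivity), ← Real.rpow_add hσ, ← sub_eq_add_neg]

/-- The weighted Hardy inequality for `E + n` along the dilations, in `lintegral` form. -/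
lemma lintegral_hardy (hn : 2 ≤ n) {p β : ℝ} (hp : 1 < p)
    (hβ : 0 < ((n : ℝ) + 2) * (p - 1) + β)
    {v : GPt n → ℝ} (hv : ContDiff ℝ (⊤ : ℕ∞) v) :
    ENNReal.ofReal (((((n : ℝ) + 2) * (p - 1) + β) / p) ^ p) *
        ∫⁻ z, ENNReal.ofReal (hardyWeight p β z) * ENNReal.ofReal (|v z| ^ p) ≤
      ∫⁻ z, ENNReal.ofReal (hardyWeight p β z) *
        ENNReal.ofReal (|gEuler v z + n * v z| ^ p) := by
  have hp0 : 0 < p := by linarith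
  set c := (((n : ℝ) + 2) * (p - 1) + β) / p with hc_def
  have hc : 0 < c := div_pos hβ hp0
  have hcp : c * p = ((n : ℝ) + 2) * (p - 1) + β := by rw [hc_def]; field_simp
  set K : GPt n → ENNReal := fun w => ENNReal.ofReal (|gEuler v w + n * v w| ^ p) with hK
  have hKm : Measurable K := by
    have : Continuous fun w => gEuler v w + n * v w :=
      (contDiff_gEuler hv).continuous.add (continuous_const.mul hv.continuous)
    exact (this.abs.measurable.pow_const p).ennreal_ofReal
  have hdil : Measurable fun x : GPt n × ℝ => gDil x.2 x.1 :=
    (continuous_gDil.comp (continuous_snd.prodMk continuous_fst)).measurable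
  calc _ = ∫⁻ z, ENNReal.ofReal (hardyWeight p β z) *
        (ENNReal.ofReal (c ^ p) * ENNReal.ofReal (|v z| ^ p)) := by
        rw [← lintegral_const_mul' _ _ ENNReal.ofReal_ne_top]
        exact lintegral_congr fun z => by ring
    _ ≤ ∫⁻ z, ENNReal.ofReal (hardyWeight p β z) * ∫⁻ σ in Set.Ioc (0 : ℝ) 1,
          ENNReal.ofReal (c * σ ^ (c - 1 + (n - c) * p)) * K (gDil σ z) :=
        lintegral_mono fun z =>
          mul_le_mul_right (ofReal_rpow_abs_le_lintegral hn hp.le hc hv z) _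
    _ = ∫⁻ z, ∫⁻ σ in Set.Ioc (0 : ℝ) 1, ENNReal.ofReal (hardyWeight p β z) *
          (ENNReal.ofReal (c * σ ^ (c - 1 + (n - c) * p)) * K (gDil σ z)) :=
        lintegral_congr fun z => (lintegral_const_mul' _ _ ENNReal.ofReal_ne_top).symm
    _ = ∫⁻ σ in Set.Ioc (0 : ℝ) 1, ∫⁻ z, ENNReal.ofReal (hardyWeight p β z) *
          (ENNReal.ofReal (c * σ ^ (c - 1 + (n - c) * p)) * K (gDil σ z)) := by
        refine lintegral_lintegral_swap (Measurable.aemeasurable ?_)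
        refine ((measurable_hardyWeight p β).ennreal_ofReal.comp measurable_fst).mul ?_
        exact Measurable.mul (by fun_prop) (hKm.comp hdil)
    _ = ∫⁻ σ in Set.Ioc (0 : ℝ) 1, ENNReal.ofReal (c * σ ^ (c - 1)) *
          ∫⁻ z, ENNReal.ofReal (hardyWeight p β z) * K z := by
        refine setLIntegral_congr_fun measurableSet_Ioc fun σ hσ => ?_
        have hσ0 : 0 < σ := hσ.1
        have hcomm : ∀ z : GPt n, ENNReal.ofReal (hardyWeight p β z) *
            (ENNReal.ofReal (c * σ ^ (c - 1 + (n - c) * p)) * K (gDil σ z)) =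
            ENNReal.ofReal (c * σ ^ (c - 1 + (n - c) * p)) *
            (ENNReal.ofReal (hardyWeight p β z) * K (gDil σ z)) := fun z => by ring
        simp only [hcomm]
        rw [lintegral_const_mul' _ _ ENNReal.ofReal_ne_top,
          lintegral_hardyWeight_mul_comp_gDil hσ0 p β hKm, ← mul_assoc,
          ← ENNReal.ofReal_mul (by positivity), mul_assoc c, ← Real.rpow_add hσ0]
        congr 4
        linear_combination -hcp
    _ = _ := by
        rw [lintegral_mul_const _ (by fun_prop), lintegral_mul_rpow_sub_one hc, one_mul]

lemma gEuler_zero (u : GPt n → ℝ) : gEuler u 0 = 0 := by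
  have : ((0 : GPt n).1, 2 * (0 : GPt n).2) = 0 := by simp
  rw [gEuler, this, map_zero]

lemma lintegral_hardyWeight_lt_top (hn : n ≠ 0) {p β : ℝ} (hp : 0 < p)
    (hβ : β < (n : ℝ) + 2 - p) {H : GPt n → ℝ} (hH : ContDiff ℝ (⊤ : ℕ∞) H)
    (hHc : HasCompactSupport H) (hH0 : H 0 = 0) :
    ∫⁻ z, ENNReal.ofReal (hardyWeight p β z) * ENNReal.ofReal (|H z| ^ p) < ⊤ := by
  obtain ⟨L, hL⟩ := hH.lipschitzWith_of_hasCompactSupport hHc (by simp)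
  obtain ⟨R, hR⟩ := hHc.isBounded.subset_closedBall 0
  set R' := max R 1
  set S := 2 * R' with hS_def
  have hS : 1 ≤ S := by linarith [le_max_right R 1]
  obtain ⟨C, -, hC⟩ := exists_map_polarMeasure_eq hn hp.le
  set a := (n : ℝ) + 2 - p - β with ha_def
  have ha : 0 < a := by linarith
  set G : ℝ → ENNReal := (Set.Iic (Real.log S)).indicator
    fun s => ENNReal.ofReal (Real.exp (a * s)) with hG_def
  have hGm : Measurable G := Measurable.indicator (by fun_prop) measurableSet_Iic
  have hbound : ∀ᵐ z : GPt n,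
      ENNReal.ofReal (hardyWeight p β z) * ENNReal.ofReal (|H z| ^ p) ≤
      ENNReal.ofReal ((L * S) ^ p) *
        (ENNReal.ofReal (polarDensity p z) * G (Real.log (gNorm z))) := by
    filter_upwards [ae_fst_ne_zero hn] with z hz1
    have hz : z ≠ 0 := fun h => hz1 (by simp [h])
    have h0 := gNorm_pos hz
    by_cases hzs : H z = 0
    · simp [hzs, Real.zero_rpow hp.ne']
    have hzS : gNorm z ≤ S := by
      refine gNorm_le_of_norm_le (le_max_right R 1) ?_
      have := hR (subset_tsupport H hzs)
      rw [Metric.mem_closedBall, dist_zero_right] at this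
      exact this.trans (le_max_left _ _)
    have hHz : |H z| ≤ L * S * gNorm z := by
      have := hL.norm_sub_le z 0
      rw [hH0, sub_zero, sub_zero, Real.norm_eq_abs] at this
      exact this.trans ((mul_le_mul_of_nonneg_left (norm_le_of_gNorm_le hS hzS) L.2).trans_eq
        (mul_assoc _ _ _).symm)
    have hmem : Real.log (gNorm z) ∈ Set.Iic (Real.log S) := Real.log_le_log h0 hzS
    have hLS : 0 ≤ (L : ℝ) * S := mul_nonneg L.2 (by linarith)
    rw [hG_def, Set.indicator_of_mem hmem, ← ENNReal.ofReal_mul (hardyWeight_nonneg p β z),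
      ← ENNReal.ofReal_mul (polarDensity_nonneg p z), ← ENNReal.ofReal_mul (by positivity)]
    refine ENNReal.ofReal_le_ofReal ?_
    have hpow : |H z| ^ p ≤ (L * S) ^ p * gNorm z ^ p := by
      rw [← Real.mul_rpow hLS h0.le]
      exact Real.rpow_le_rpow (abs_nonneg _) hHz hp.le
    have hexp : Real.exp (a * Real.log (gNorm z)) = gNorm z ^ a := by
      rw [Real.rpow_def_of_pos h0, mul_comm]
    have hpowadd : gNorm z ^ (-(2 * p + β)) * gNorm z ^ p
        = gNorm z ^ (-((n : ℝ) + 2)) * gNorm z ^ a := by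
      rw [← Real.rpow_add h0, ← Real.rpow_add h0]
      congr 1
      rw [ha_def]; ring
    calc hardyWeight p β z * |H z| ^ p
        ≤ hardyWeight p β z * ((L * S) ^ p * gNorm z ^ p) :=
          mul_le_mul_of_nonneg_left hpow (hardyWeight_nonneg p β z)
      _ = (L * S) ^ p * (gPsi z ^ (p / 2) * (gNorm z ^ (-(2 * p + β)) * gNorm z ^ p)) := by
          unfold hardyWeight; ring
      _ = _ := by rw [hpowadd, hexp]; unfold polarDensity; ring
  refine (lintegral_mono_ae hbound).trans_lt ?_
  rw [lintegral_const_mul' _ _ ENNReal.ofReal_ne_top, ← lintegral_map_polarMeasure p hGm, hC]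
  refine ENNReal.mul_lt_top ENNReal.ofReal_lt_top ?_
  rw [lintegral_smul_measure, hG_def, lintegral_indicator measurableSet_Iic]
  refine ENNReal.mul_lt_top ENNReal.coe_lt_top ?_
  have h_int := (integrableOn_exp_mul_Iic ha (Real.log S)).lintegral_lt_top
  exact h_int

lemma integrand_radialLap_eq {p β : ℝ} {u : GPt n → ℝ} (hu : ContDiff ℝ (⊤ : ℕ∞) u)
    {z : GPt n} (hz : z.1 ≠ 0) :
    |radialLap ((n : ℝ) + 2) u z| ^ p / (gPsi z ^ (p / 2) * gNorm z ^ β)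
      = hardyWeight p β z * |gEuler (gEuler u) z + n * gEuler u z| ^ p := by
  have hz0 : z ≠ 0 := fun h => hz (by simp [h])
  have h0 := gNorm_pos hz0
  have hψ := gPsi_pos hz
  rw [radialLap_eq (hu.differentiable (by simp)) ((contDiff_gEuler hu).differentiable (by simp)) hz0,
    abs_mul, abs_div, abs_of_pos hψ, abs_of_pos (pow_pos h0 2), Real.mul_rpow hψ.le (by positivity),
    Real.div_rpow (abs_nonneg _) (by positivity), hardyWeight]
  have h1 : gPsi z ^ p = gPsi z ^ (p / 2) * gPsi z ^ (p / 2) := by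
    rw [← Real.rpow_add hψ]; congr 1; ring
  have h2 : gNorm z ^ (-(2 * p + β)) = ((gNorm z ^ 2) ^ p * gNorm z ^ β)⁻¹ := by
    rw [Real.rpow_neg h0.le, Real.rpow_add h0, Real.rpow_mul h0.le, Real.rpow_two]
  rw [h1, h2]
  have h3 : 0 < gPsi z ^ (p / 2) := Real.rpow_pos_of_pos hψ _
  field_simp

lemma integrand_radialDeriv_eq {p β : ℝ} {u : GPt n → ℝ} (hu : ContDiff ℝ (⊤ : ℕ∞) u)
    {z : GPt n} (hz : z.1 ≠ 0) :
    gPsi z ^ (p / 2) * |radialDeriv u z| ^ p / gNorm z ^ (p + β)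
      = hardyWeight p β z * |gEuler u z| ^ p := by
  have hz0 : z ≠ 0 := fun h => hz (by simp [h])
  have h0 := gNorm_pos hz0
  rw [radialDeriv_eq (hu.differentiable (by simp)), abs_div, abs_of_pos h0,
    Real.div_rpow (abs_nonneg _) h0.le, hardyWeight]
  have h2 : gNorm z ^ (-(2 * p + β)) = (gNorm z ^ p * gNorm z ^ (p + β))⁻¹ := by
    rw [Real.rpow_neg h0.le, ← Real.rpow_add h0]; congr 2; ring
  rw [h2]
  field_simp

lemma integral_hardyWeight_mul (p β : ℝ) {H : GPt n → ℝ} (hH : Continuous H) :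
    ∫ z, hardyWeight p β z * |H z| ^ p =
      (∫⁻ z, ENNReal.ofReal (hardyWeight p β z) * ENNReal.ofReal (|H z| ^ p)).toReal := by
  rw [integral_eq_lintegral_of_nonneg_ae]
  · congr 1
    exact lintegral_congr fun z => ENNReal.ofReal_mul (hardyWeight_nonneg p β z)
  · exact Filter.Eventually.of_forall fun z =>
      mul_nonneg (hardyWeight_nonneg p β z) (Real.rpow_nonneg (abs_nonneg _) _)
  · exact ((measurable_hardyWeight p β).mul
      (hH.abs.measurable.pow_const p)).aestronglyMeasurable

theorem hardy_rellich_le (hn : 2 ≤ n) {p β : ℝ} (hp : 1 < p)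
    (hβ1 : -(((n : ℝ) + 2) * (p - 1)) < β) (hβ2 : β < (n : ℝ) + 2 - p)
    {u : GPt n → ℝ} (hu : ContDiff ℝ (⊤ : ℕ∞) u) (huc : HasCompactSupport u) :
    ((((n : ℝ) + 2) * (p - 1) + β) / p) ^ p *
        ∫ z : GPt n, gPsi z ^ (p / 2) * |radialDeriv u z| ^ p / gNorm z ^ (p + β) ≤
      ∫ z : GPt n, |radialLap ((n : ℝ) + 2) u z| ^ p / (gPsi z ^ (p / 2) * gNorm z ^ β) := by
  have hn0 : n ≠ 0 := by omega
  have hEu := contDiff_gEuler hu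
  have hEuc := hasCompactSupport_gEuler huc
  have hHs : ContDiff ℝ (⊤ : ℕ∞) fun z => gEuler (gEuler u) z + n * gEuler u z :=
    (contDiff_gEuler hEu).add (contDiff_const.mul hEu)
  have hHc : HasCompactSupport fun z => gEuler (gEuler u) z + n * gEuler u z :=
    (hasCompactSupport_gEuler hEuc).add hEuc.mul_left
  have hL : ∫ z : GPt n, |radialLap ((n : ℝ) + 2) u z| ^ p / (gPsi z ^ (p / 2) * gNorm z ^ β)
      = ∫ z, hardyWeight p β z * |gEuler (gEuler u) z + n * gEuler u z| ^ p :=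
    integral_congr_ae ((ae_fst_ne_zero hn0).mono fun z hz => integrand_radialLap_eq hu hz)
  have hR : ∫ z : GPt n, gPsi z ^ (p / 2) * |radialDeriv u z| ^ p / gNorm z ^ (p + β)
      = ∫ z, hardyWeight p β z * |gEuler u z| ^ p :=
    integral_congr_ae ((ae_fst_ne_zero hn0).mono fun z hz => integrand_radialDeriv_eq hu hz)
  rw [hL, hR, integral_hardyWeight_mul p β hHs.continuous,
    integral_hardyWeight_mul p β hEu.continuous]
  have hβ : 0 < ((n : ℝ) + 2) * (p - 1) + β := by linarith
  have hfin := lintegral_hardyWeight_lt_top hn0 (by linarith) hβ2 hHs hHc (by simp [gEuler_zero])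
  have h := ENNReal.toReal_mono hfin.ne (lintegral_hardy hn hp hβ hEu)
  have hc : 0 ≤ ((((n : ℝ) + 2) * (p - 1) + β) / p) ^ p :=
    Real.rpow_nonneg (div_nonneg hβ.le (by linarith)) _
  rwa [ENNReal.toReal_mul, ENNReal.toReal_ofReal hc] at h

lemma integral_polarDensity_mul {p : ℝ} {C : NNReal}
    (hC : (polarMeasure n p).map (fun z => Real.log (gNorm z)) = C • (volume : Measure ℝ))
    {g : ℝ → ℝ} (hg : Continuous g) :
    ∫ z : GPt n, polarDensity p z * g (Real.log (gNorm z)) = C * ∫ s, g s := by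
  have h1 : ∫ s, g s ∂((polarMeasure n p).map (fun z => Real.log (gNorm z))) = C * ∫ s, g s := by
    rw [hC, integral_smul_nnreal_measure]
    rfl
  rw [← h1, integral_map measurable_log_gNorm.aemeasurable hg.aestronglyMeasurable, polarMeasure,
    integral_withDensity_eq_integral_toReal_smul (measurable_polarDensity p).ennreal_ofReal
      (Filter.Eventually.of_forall fun _ => ENNReal.ofReal_lt_top)]
  refine integral_congr_ae (Filter.Eventually.of_forall fun z => ?_)
  simp [ENNReal.toReal_ofReal (polarDensity_nonneg p z)]

lemma radialDeriv_of_log {V : ℝ → ℝ} {d : ℝ} {u : GPt n → ℝ} {z : GPt n} (hz : z ≠ 0)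
    (hu : ∀ w ≠ 0, u w = V (Real.log (gNorm w))) (hV : HasDerivAt V d (Real.log (gNorm z))) :
    radialDeriv u z = d / gNorm z := by
  have h0 := gNorm_pos hz
  rw [radialDeriv_eq_deriv_gDil]
  have h1 : (fun s => u (gDil (s / gNorm z) z)) =ᶠ[nhds (gNorm z)] V ∘ Real.log := by
    filter_upwards [lt_mem_nhds h0] with s hs
    have hN := gNorm_gDil_div hz hs
    rw [hu _ fun h => ?_, hN]
    · rfl
    · rw [h, gNorm_zero] at hN
      exact hs.ne hN
  rw [h1.deriv_eq, (hV.comp _ (Real.hasDerivAt_log h0.ne')).deriv, div_eq_mul_inv]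

/-- Radial test functions with prescribed radial derivative, as a function of `log ϱ`. -/
lemma exists_isTest_radialDeriv_eq (n : ℕ) {ζ : ℝ → ℝ} (hζ : ContDiff ℝ (⊤ : ℕ∞) ζ) {a b : ℝ}
    (ha : 0 < a) (hsupp : ∀ s, ζ s ≠ 0 → a ≤ s ∧ s ≤ b) (γ : ℝ) :
    ∃ u : GPt n → ℝ, IsTest Set.univ u ∧ ∀ z ≠ 0, radialDeriv u z =
      Real.exp (γ * Real.log (gNorm z)) * ζ (Real.log (gNorm z)) := by
  set θ : ℝ → ℝ := fun τ => ζ (Real.log τ / 4) * Real.exp ((γ - 3) * (Real.log τ / 4)) / 4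
    with hθ_def
  have hθ : ContDiff ℝ (⊤ : ℕ∞) θ := by
    rw [contDiff_iff_contDiffAt]
    intro τ
    by_cases hτ : τ = 0
    · have : θ =ᶠ[nhds τ] fun _ => 0 := by
        filter_upwards [Metric.ball_mem_nhds τ one_pos] with x hx
        rw [hτ, Metric.mem_ball, dist_zero_right, Real.norm_eq_abs] at hx
        have hlog : Real.log x ≤ 0 := by
          rw [← Real.log_abs]; exact Real.log_nonpos (abs_nonneg _) hx.le
        have : ζ (Real.log x / 4) = 0 := by
          by_contra h
          have := (hsupp _ h).1
          linarith
        simp [hθ_def, this]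
      exact contDiffAt_const.congr_of_eventuallyEq this
    · have hl : ContDiffAt ℝ (⊤ : ℕ∞) (fun x : ℝ => Real.log x / 4) τ :=
        (Real.contDiffAt_log.2 hτ).div_const _
      exact ((hζ.contDiffAt.comp τ hl).mul (contDiffAt_const.mul hl).exp).div_const _
  set Y := Real.exp (4 * b)
  set F : ℝ → ℝ := fun y => ∫ τ in Y..y, θ τ with hF_def
  have hFd : ∀ y, HasDerivAt F (θ y) y := fun y =>
    (hθ.continuous.integral_hasStrictDerivAt Y y).hasDerivAt
  have hF : ContDiff ℝ (⊤ : ℕ∞) F := by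
    rw [contDiff_infty_iff_deriv]
    refine ⟨fun y => (hFd y).differentiableAt, ?_⟩
    rwa [show deriv F = θ from funext fun y => (hFd y).deriv]
  have hF0 : ∀ y, Y < y → F y = 0 := by
    intro y hy
    rw [hF_def]
    refine (intervalIntegral.integral_congr_ae
      (Filter.Eventually.of_forall fun τ hτ => ?_)).trans intervalIntegral.integral_zero
    rw [Set.uIoc_of_le hy.le] at hτ
    have hlog : 4 * b < Real.log τ :=
      (Real.lt_log_iff_exp_lt ((Real.exp_pos _).trans hτ.1)).2 hτ.1
    have : ζ (Real.log τ / 4) = 0 := by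
      by_contra h
      have := (hsupp _ h).2
      linarith
    simp [hθ_def, this]
  refine ⟨fun z => F (gNorm z ^ 4), ⟨?_, ?_, Set.subset_univ _⟩, ?_⟩
  · refine hF.comp ?_
    have : (fun z : GPt n => gNorm z ^ 4) = fun z => (‖z.1‖ ^ 2) ^ 2 + 4 * z.2 ^ 2 := by
      funext z; rw [gNorm_pow_four]; ring
    rw [this]
    exact (contDiff_fst.norm_sq ℝ |>.pow 2).add (contDiff_const.mul (contDiff_snd.pow 2))
  · refine HasCompactSupport.intro (isCompact_closedBall (0 : GPt n) (max Y 1 * max Y 1))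
      fun z hz => hF0 _ ?_
    by_contra! hle
    refine hz ?_
    have hM : 1 ≤ max Y 1 := le_max_right _ _
    have h4 : gNorm z ≤ max Y 1 := by
      by_contra! hlt
      have h1 : 1 ≤ gNorm z := hM.trans hlt.le
      have h2 : gNorm z ≤ gNorm z ^ 4 := le_self_pow₀ h1 (by norm_num)
      exact absurd (h2.trans (hle.trans (le_max_left Y 1))) (not_le.2 hlt)
    rw [Metric.mem_closedBall, dist_zero_right]
    exact (norm_le_of_gNorm_le hM h4).trans (mul_le_mul_of_nonneg_left h4 (by linarith))
  · intro z hz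
    have h0 := gNorm_pos hz
    set s := Real.log (gNorm z) with hs
    have hV : HasDerivAt (fun σ => F (Real.exp (4 * σ)))
        (θ (Real.exp (4 * s)) * (Real.exp (4 * s) * 4)) s := by
      have h1 : HasDerivAt (fun σ : ℝ => 4 * σ) 4 s := by
        simpa using (hasDerivAt_id s).const_mul 4
      exact (hFd _).comp s h1.exp
    rw [radialDeriv_of_log (V := fun σ => F (Real.exp (4 * σ))) hz (fun w hw => ?_) hV]
    · have h4 : Real.log (Real.exp (4 * s)) / 4 = s := by rw [Real.log_exp]; ring
      have h5 : gNorm z = Real.exp s := (Real.exp_log h0).symm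
      simp only [hθ_def, h4]
      rw [h5, div_eq_iff (Real.exp_pos s).ne']
      have h6 : Real.exp ((γ - 3) * s) * Real.exp (4 * s) = Real.exp (γ * s) * Real.exp s := by
        rw [← Real.exp_add, ← Real.exp_add]; congr 1; ring
      linear_combination ζ s * h6
    · have : Real.exp (4 * Real.log (gNorm w)) = gNorm w ^ 4 := by
        rw [← Real.exp_log (pow_pos (gNorm_pos hw) 4), Real.log_pow]
        norm_num
      simp only [this]

/-- Testing with radial functions reduces the inequality to one on the line. -/
lemma integral_le_of_forall_isTest (hn : n ≠ 0) {p β κ : ℝ} (hp : 1 < p)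
    (hκ : ∀ u : GPt n → ℝ, IsTest Set.univ u →
      (∫ z : GPt n, |radialLap ((n : ℝ) + 2) u z| ^ p / (gPsi z ^ (p / 2) * gNorm z ^ β)) ≥
        κ * ∫ z : GPt n, gPsi z ^ (p / 2) * |radialDeriv u z| ^ p / gNorm z ^ (p + β))
    {ζ : ℝ → ℝ} (hζ : ContDiff ℝ (⊤ : ℕ∞) ζ) {a b : ℝ}
    (ha : 0 < a) (hsupp : ∀ s, ζ s ≠ 0 → a ≤ s ∧ s ≤ b) :
    κ * ∫ s, |ζ s| ^ p ≤
      ∫ s, |(((n : ℝ) + 2) * (p - 1) + β) / p * ζ s + deriv ζ s| ^ p := by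
  have hp0 : 0 < p := by linarith
  set c := (((n : ℝ) + 2) * (p - 1) + β) / p with hc_def
  have hcp : c * p = ((n : ℝ) + 2) * (p - 1) + β := by rw [hc_def]; field_simp
  obtain ⟨C, hC0, hC⟩ := exists_map_polarMeasure_eq hn hp0.le
  set γ := c - (n + 1) with hγ
  obtain ⟨u, hu, hud⟩ := exists_isTest_radialDeriv_eq n hζ ha hsupp γ
  have hζd : Continuous (deriv ζ) := hζ.continuous_deriv (by simp)
  have hudd : ∀ z : GPt n, z ≠ 0 → radialDeriv (radialDeriv u) z =
      Real.exp (γ * Real.log (gNorm z)) *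
        (γ * ζ (Real.log (gNorm z)) + deriv ζ (Real.log (gNorm z))) / gNorm z := by
    intro z hz
    have h1 : HasDerivAt (fun s : ℝ => γ * s) γ (Real.log (gNorm z)) := by
      simpa using (hasDerivAt_id (Real.log (gNorm z))).const_mul γ
    have h2 := h1.exp.mul (hζ.differentiable (by simp) (Real.log (gNorm z))).hasDerivAt
    rw [radialDeriv_of_log hz hud h2]
    congr 1
    ring
  have hL : ∫ z : GPt n, |radialLap ((n : ℝ) + 2) u z| ^ p / (gPsi z ^ (p / 2) * gNorm z ^ β)
      = C * ∫ s, |c * ζ s + deriv ζ s| ^ p := by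
    rw [← integral_polarDensity_mul hC (g := fun s => |c * ζ s + deriv ζ s| ^ p)
      (((continuous_const.mul hζ.continuous).add hζd).abs.rpow_const fun _ => Or.inr hp0.le)]
    refine integral_congr_ae ((ae_fst_ne_zero hn).mono fun z hz1 => ?_)
    have hz : z ≠ 0 := fun h => hz1 (by simp [h])
    have h0 := gNorm_pos hz
    have hψ := gPsi_pos hz1
    set s := Real.log (gNorm z) with hs
    have hlap : radialLap ((n : ℝ) + 2) u z
        = gPsi z * (gNorm z ^ (γ - 1) * (c * ζ s + deriv ζ s)) := by
      rw [radialLap, hudd z hz, hud z hz, Real.rpow_sub_one h0.ne', Real.rpow_def_of_pos h0, ← hs,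
        mul_comm s γ, hγ]
      field_simp
      ring
    have h1 : gPsi z ^ p = gPsi z ^ (p / 2) * gPsi z ^ (p / 2) := by
      rw [← Real.rpow_add hψ]; congr 1; ring
    have h2 : gNorm z ^ ((γ - 1) * p) = gNorm z ^ (-((n : ℝ) + 2)) * gNorm z ^ β := by
      rw [← Real.rpow_add h0]
      congr 1
      rw [hγ]
      linear_combination hcp
    have h3 : 0 < gPsi z ^ (p / 2) := Real.rpow_pos_of_pos hψ _
    have h4 : 0 < gNorm z ^ β := Real.rpow_pos_of_pos h0 _
    simp only [hlap, polarDensity, ← hs]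
    rw [abs_mul, abs_mul, abs_of_pos hψ, abs_of_pos (Real.rpow_pos_of_pos h0 _),
      Real.mul_rpow hψ.le (by positivity), Real.mul_rpow (by positivity) (abs_nonneg _),
      ← Real.rpow_mul h0.le, h1, h2]
    field_simp
  have hR : ∫ z : GPt n, gPsi z ^ (p / 2) * |radialDeriv u z| ^ p / gNorm z ^ (p + β)
      = C * ∫ s, |ζ s| ^ p := by
    rw [← integral_polarDensity_mul hC (g := fun s => |ζ s| ^ p)
      (hζ.continuous.abs.rpow_const fun _ => Or.inr hp0.le)]
    refine integral_congr_ae ((ae_fst_ne_zero hn).mono fun z hz1 => ?_)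
    have hz : z ≠ 0 := fun h => hz1 (by simp [h])
    have h0 := gNorm_pos hz
    set s := Real.log (gNorm z) with hs
    have hder : radialDeriv u z = gNorm z ^ γ * ζ s := by
      rw [hud z hz, Real.rpow_def_of_pos h0, ← hs, mul_comm s γ]
    have h2 : gNorm z ^ (γ * p) = gNorm z ^ (-((n : ℝ) + 2)) * gNorm z ^ (p + β) := by
      rw [← Real.rpow_add h0]
      congr 1
      rw [hγ]
      linear_combination hcp
    have h4 : 0 < gNorm z ^ (p + β) := Real.rpow_pos_of_pos h0 _
    simp only [hder, polarDensity, ← hs]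
    rw [abs_mul, abs_of_pos (Real.rpow_pos_of_pos h0 _),
      Real.mul_rpow (by positivity) (abs_nonneg _), ← Real.rpow_mul h0.le, h2]
    field_simp
  have h := hκ u hu
  rw [hL, hR] at h
  have hC' : (0 : ℝ) < C := NNReal.coe_pos.2 hC0
  refine le_of_mul_le_mul_left ?_ hC'
  linarith

theorem le_of_forall_isTest (hn : n ≠ 0) {p β κ : ℝ} (hp : 1 < p)
    (hβ : 0 < ((n : ℝ) + 2) * (p - 1) + β)
    (hκ : ∀ u : GPt n → ℝ, IsTest Set.univ u →
      (∫ z : GPt n, |radialLap ((n : ℝ) + 2) u z| ^ p / (gPsi z ^ (p / 2) * gNorm z ^ β)) ≥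
        κ * ∫ z : GPt n, gPsi z ^ (p / 2) * |radialDeriv u z| ^ p / gNorm z ^ (p + β)) :
    κ ≤ ((((n : ℝ) + 2) * (p - 1) + β) / p) ^ p := by
  have hp0 : 0 < p := by linarith
  have hred := fun (ζ : ℝ → ℝ) (hζ : ContDiff ℝ (⊤ : ℕ∞) ζ) (a b : ℝ) (ha : 0 < a) =>
    integral_le_of_forall_isTest hn hp hκ hζ (a := a) (b := b) ha
  set c := (((n : ℝ) + 2) * (p - 1) + β) / p with hc_def
  have hc : 0 < c := div_pos hβ hp0
  let η : ContDiffBump (2 : ℝ) := ⟨1 / 2, 1, by norm_num, by norm_num⟩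
  have hη : ContDiff ℝ (⊤ : ℕ∞) η := η.contDiff
  have hηd : Continuous (deriv η) := hη.continuous_deriv (by simp)
  have hηs : ∀ s, η s ≠ 0 → 1 ≤ s ∧ s ≤ 3 := by
    intro s hs
    have : s ∈ Function.support η := hs
    rw [η.support_eq, Metric.mem_ball, Real.dist_eq, abs_lt] at this
    have h1 : η.rOut = 1 := rfl
    rw [h1] at this
    constructor <;> linarith
  have hpc : Continuous fun x : ℝ => |x| ^ p :=
    continuous_abs.rpow_const fun _ => Or.inr hp0.le
  have hp_abs0 : |(0 : ℝ)| ^ p = 0 := by rw [abs_zero, Real.zero_rpow hp0.ne']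
  have key : ∀ ε : ℝ, 0 < ε →
      κ * ∫ s, |η s| ^ p ≤ ∫ s, |c * η s + ε * deriv η s| ^ p := by
    intro ε hε
    have h := hred (fun s => η (ε * s)) (hη.comp (contDiff_const.mul contDiff_id)) (1 / ε) (3 / ε)
      (by positivity) fun s hs => by
        have := hηs _ hs
        rw [div_le_iff₀ hε, le_div_iff₀ hε, mul_comm s ε]
        exact this
    have hd : ∀ s, deriv (fun s => η (ε * s)) s = ε * deriv η (ε * s) := fun s => by
      simpa using deriv_comp_mul_left ε η s
    simp only [hd] at h
    rw [Measure.integral_comp_mul_left (fun s => |η s| ^ p) ε,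
      Measure.integral_comp_mul_left (fun s => |c * η s + ε * deriv η s| ^ p) ε] at h
    have hε' : 0 < |ε⁻¹| := by positivity
    simp only [smul_eq_mul] at h
    refine le_of_mul_le_mul_left ?_ hε'
    linarith
  have hlim : Filter.Tendsto (fun ε : ℝ => ∫ s, |c * η s + ε * deriv η s| ^ p)
      (nhdsWithin 0 (Set.Ioi 0)) (nhds (∫ s, |c * η s + 0 * deriv η s| ^ p)) := by
    refine tendsto_integral_filter_of_dominated_convergence
      (fun s => (c * |η s| + |deriv η s|) ^ p) ?_ ?_ ?_ ?_
    · refine Filter.Eventually.of_forall fun ε => Continuous.aestronglyMeasurable ?_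
      exact hpc.comp ((continuous_const.mul hη.continuous).add (continuous_const.mul hηd))
    · filter_upwards [Ioo_mem_nhdsGT (zero_lt_one' ℝ)] with ε hε
      refine Filter.Eventually.of_forall fun s => ?_
      rw [Real.norm_eq_abs, abs_of_nonneg (by positivity)]
      refine Real.rpow_le_rpow (abs_nonneg _) ?_ hp0.le
      refine (abs_add_le _ _).trans ?_
      rw [abs_mul, abs_mul, abs_of_pos hc, abs_of_pos hε.1]
      have := mul_le_of_le_one_left (abs_nonneg (deriv η s)) hε.2.le
      linarith
    · refine Continuous.integrable_of_hasCompactSupport ?_ ?_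
      · exact ((continuous_const.mul hη.continuous.abs).add hηd.abs).rpow_const
          fun _ => Or.inr hp0.le
      · refine HasCompactSupport.comp_left (g := fun x : ℝ => x ^ p) ?_ (Real.zero_rpow hp0.ne')
        exact (η.hasCompactSupport.abs.mul_left).add η.hasCompactSupport.deriv.abs
    · refine Filter.Eventually.of_forall fun s => ?_
      have : Continuous fun ε : ℝ => |c * η s + ε * deriv η s| ^ p :=
        hpc.comp (by fun_prop)
      exact this.continuousAt.tendsto.mono_left nhdsWithin_le_nhds
  have hle : κ * ∫ s, |η s| ^ p ≤ ∫ s, |c * η s + 0 * deriv η s| ^ p :=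
    ge_of_tendsto hlim (by filter_upwards [self_mem_nhdsWithin] with ε hε using key ε hε)
  have heq : ∫ s, |c * η s + 0 * deriv η s| ^ p = c ^ p * ∫ s, |η s| ^ p := by
    rw [← integral_const_mul]
    refine integral_congr_ae (Filter.Eventually.of_forall fun s => ?_)
    simp only [zero_mul, add_zero]
    rw [abs_mul, abs_of_pos hc, Real.mul_rpow hc.le (abs_nonneg _)]
  have hpos : 0 < ∫ s, |η s| ^ p := by
    refine Continuous.integral_pos_of_hasCompactSupport_nonneg_nonzero
      (x := 2) (hpc.comp hη.continuous) ?_ (fun s => by positivity) ?_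
    · exact η.hasCompactSupport.comp_left (g := fun x : ℝ => |x| ^ p) hp_abs0
    · have : η 2 = 1 := η.one_of_mem_closedBall (Metric.mem_closedBall_self (by norm_num [η]))
      simp [this]
  rw [heq] at hle
  exact le_of_mul_le_mul_right hle hpos

end Auxiliary

/-- Hardy–Rellich inequality for the radial Grushin operator, with best
constant `((Q(p−1)+β)/p)^p` (Theorem 4.2 of the paper). -/
theorem hardy_rellich_inequality
    (n : ℕ) (Q : ℝ) (hQ : Q = n + 2) (hQ4 : 4 ≤ Q)
    (p β : ℝ) (hp : 1 < p) (hpQ : p < Q) (hβ1 : -(Q * (p - 1)) < β) (hβ2 : β < Q - p) :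
    (∀ u : GPt n → ℝ, IsTest Set.univ u →
      (∫ z : GPt n, |radialLap Q u z| ^ p / (gPsi z ^ (p / 2) * gNorm z ^ β))
        ≥ ((Q * (p - 1) + β) / p) ^ p *
            ∫ z : GPt n, gPsi z ^ (p / 2) * |radialDeriv u z| ^ p / gNorm z ^ (p + β))
    ∧ ∀ κ : ℝ,
        (∀ u : GPt n → ℝ, IsTest Set.univ u →
          (∫ z : GPt n, |radialLap Q u z| ^ p / (gPsi z ^ (p / 2) * gNorm z ^ β))
            ≥ κ *
                ∫ z : GPt n,
                  gPsi z ^ (p / 2) * |radialDeriv u z| ^ p / gNorm z ^ (p + β)) →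
        κ ≤ ((Q * (p - 1) + β) / p) ^ p := by
  subst hQ
  have hn : 2 ≤ n := by
    have : (2 : ℝ) ≤ n := by linarith
    exact_mod_cast this
  exact ⟨fun u hu => hardy_rellich_le hn hp hβ1 hβ2 hu.1 hu.2.1,
    fun κ hκ => le_of_forall_isTest (by omega) hp (by linarith) hκ⟩
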